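/- Let u_ε be a classical solution of the regularized anisotropic problem with ε ∈ (0,ε₀], satisfying |u_ε| ≤ M on Q̄_T, and suppose F satisfies the monotonicity condition F(x,u,z) ≤ F(x,v,z) whenever u ≥ v. Then for every δ > 0 and all (t,x) ∈ Q̄_T one has the one-sided estimate u_ε(t,x) − u₀(x) ≤ (K+δ)t, where K is the constant defined in the context. -/

import Mathlib

open Set Filter MeasureTheory Metric

noncomputable section

/-- The `i`-th partial derivative of a function on Euclidean space. -/
def pd {n : ℕ} (f : EuclideanSpace ℝ (Fin n) → ℝ) (i : Fin n)
    (x : EuclideanSpace ℝ (Fin n)) : ℝ :=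
  fderiv ℝ f x (EuclideanSpace.single i 1)

/-- The gradient vector of a function on Euclidean space. -/
def gradv {n : ℕ} (f : EuclideanSpace ℝ (Fin n) → ℝ)
    (x : EuclideanSpace ℝ (Fin n)) : EuclideanSpace ℝ (Fin n) :=
  (WithLp.equiv 2 (Fin n → ℝ)).symm (fun i => pd f i x)

/-- The exterior sphere condition for a domain. -/
def ExteriorSphereCond {n : ℕ} (Ω : Set (EuclideanSpace ℝ (Fin n))) : Prop :=
  ∀ y ∈ frontier Ω, ∃ z r, 0 < r ∧ closedBall z r ∩ closure Ω = {y}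

/-- `f` is of class `C^{1+γ}` on `s` (C¹ with γ-Hölder continuous derivative). -/
def C1HolderOn {n : ℕ} (γ : ℝ) (s : Set (EuclideanSpace ℝ (Fin n)))
    (f : EuclideanSpace ℝ (Fin n) → ℝ) : Prop :=
  ContDiffOn ℝ 1 f s ∧
    ∃ C : NNReal, HolderOnWith C γ.toNNReal (fun x => fderivWithin ℝ f s x) s

/-- Classical solution of the regularized anisotropic problem
`u_t = ∑ᵢ ((u_{xᵢ}² + ε)^{pᵢ(x)/2} u_{xᵢ})_{xᵢ} + F(x, u, ∇u)` in `Q_T = (0,T) × Ω`,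
with `u = ψ` on `∂Ω × (0,T)` and `u(0,·) = u₀` in `Ω`. -/
structure IsClassicalSolAniso {n : ℕ} (Ω : Set (EuclideanSpace ℝ (Fin n))) (T : ℝ)
    (p : Fin n → EuclideanSpace ℝ (Fin n) → ℝ)
    (F : EuclideanSpace ℝ (Fin n) → ℝ → EuclideanSpace ℝ (Fin n) → ℝ)
    (ψ u₀ : EuclideanSpace ℝ (Fin n) → ℝ) (ε : ℝ)
    (u : ℝ → EuclideanSpace ℝ (Fin n) → ℝ) : Prop where
  cont : ContinuousOn (fun q : ℝ × EuclideanSpace ℝ (Fin n) => u q.1 q.2)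
      (Icc 0 T ×ˢ closure Ω)
  diff_t : ∀ t ∈ Ioo 0 T, ∀ x ∈ Ω, DifferentiableAt ℝ (fun s => u s x) t
  smooth_x : ∀ t ∈ Ioo 0 T, ∀ x ∈ Ω, ContDiffAt ℝ 2 (u t) x
  cont_ut : ContinuousOn
      (fun q : ℝ × EuclideanSpace ℝ (Fin n) => deriv (fun s => u s q.2) q.1) (Ioo 0 T ×ˢ Ω)
  cont_ux : ∀ i, ContinuousOn
      (fun q : ℝ × EuclideanSpace ℝ (Fin n) => pd (u q.1) i q.2) (Ioo 0 T ×ˢ Ω)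
  cont_uxx : ∀ i j, ContinuousOn
      (fun q : ℝ × EuclideanSpace ℝ (Fin n) => pd (fun y => pd (u q.1) j y) i q.2)
      (Ioo 0 T ×ˢ Ω)
  eqn : ∀ t ∈ Ioo 0 T, ∀ x ∈ Ω,
      deriv (fun s => u s x) t =
        (∑ i, pd (fun y => ((pd (u t) i y) ^ 2 + ε) ^ (p i y / 2) * pd (u t) i y) i x)
          + F x (u t x) (gradv (u t) x)
  bdry : ∀ t ∈ Ioo 0 T, ∀ x ∈ frontier Ω, u t x = ψ x
  init : ∀ x ∈ closure Ω, u 0 x = u₀ x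

/-- The partial derivatives of a function of class `C²` are differentiable. -/
theorem ContDiffAt.differentiableAt_pd {n : ℕ} {f : EuclideanSpace ℝ (Fin n) → ℝ}
    {x : EuclideanSpace ℝ (Fin n)} (hf : ContDiffAt ℝ 2 f x) (i : Fin n) :
    DifferentiableAt ℝ (fun y => pd f i y) x := by
  have h : ContDiffAt ℝ 1 (fderiv ℝ f) x := hf.fderiv_right (by norm_num)
  exact (h.differentiableAt (by norm_num)).clm_apply (differentiableAt_const _)

/-- The `i`-th term of the regularized anisotropic operator in nondivergence form. -/
theorem pd_flux {n : ℕ} {f q : EuclideanSpace ℝ (Fin n) → ℝ} {x : EuclideanSpace ℝ (Fin n)}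
    {i : Fin n} {ε : ℝ} (hε : 0 < ε) (hf : DifferentiableAt ℝ (fun y => pd f i y) x)
    (hq : DifferentiableAt ℝ q x) :
    pd (fun y => ((pd f i y) ^ 2 + ε) ^ (q y / 2) * pd f i y) i x =
      ((pd f i x) ^ 2 + ε) ^ (q x / 2) * Real.log ((pd f i x) ^ 2 + ε) * (pd q i x / 2) *
          pd f i x +
        ((pd f i x) ^ 2 + ε) ^ (q x / 2 - 1) * (ε + (1 + q x) * (pd f i x) ^ 2) *
          pd (fun y => pd f i y) i x := by
  have hs : 0 < (pd f i x) ^ 2 + ε := by positivity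
  have hbase := (hf.hasFDerivAt.pow 2).add_const ε
  have hexp := hq.hasFDerivAt.mul_const (1 / 2 : ℝ)
  have hmul := (hbase.rpow hexp hs).mul hf.hasFDerivAt
  have heq : (fun y => ((pd f i y) ^ 2 + ε) ^ (q y / 2) * pd f i y) =
      (fun y => ((pd f i y) ^ 2 + ε) ^ (q y * (1 / 2)) * pd f i y) := by
    funext y
    rw [div_eq_mul_one_div]
  have hpow : ((pd f i x) ^ 2 + ε) ^ (q x / 2) =
      ((pd f i x) ^ 2 + ε) ^ (q x / 2 - 1) * ((pd f i x) ^ 2 + ε) := by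
    rw [← Real.rpow_add_one hs.ne', sub_add_cancel]
  have hhalf : q x * (1 / 2) = q x / 2 := by ring
  rw [heq]
  unfold pd at *
  refine (DFunLike.congr_fun hmul.fderiv (EuclideanSpace.single i 1)).trans ?_
  simp only [hhalf, ContinuousLinearMap.add_apply, ContinuousLinearMap.smul_apply, smul_eq_mul]
  rw [hpow]
  norm_num
  ring

/-- At an interior maximum the pure second derivatives are nonpositive. -/
theorem IsLocalMax.pd_pd_nonpos {n : ℕ} {f : EuclideanSpace ℝ (Fin n) → ℝ}
    {x : EuclideanSpace ℝ (Fin n)} (hmax : IsLocalMax f x) (hf : ContDiffAt ℝ 2 f x)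
    (i : Fin n) : pd (fun y => pd f i y) i x ≤ 0 := by
  set e : EuclideanSpace ℝ (Fin n) := EuclideanSpace.single i 1 with he
  let ℓ : ℝ → EuclideanSpace ℝ (Fin n) := fun s => x + s • e
  have hℓ0 : ℓ 0 = x := by simp [ℓ]
  have hℓd (s : ℝ) : HasDerivAt ℓ e s := by
    have h := ((hasDerivAt_id s).smul_const e).const_add x
    rw [one_smul] at h
    exact h
  have hℓ : Tendsto ℓ (nhds 0) (nhds x) := by
    simpa [hℓ0] using (hℓd 0).continuousAt.tendsto
  have hdiff : ∀ᶠ y in nhds x, DifferentiableAt ℝ f y :=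
    (hf.eventually (by simp)).mono fun y hy => hy.differentiableAt (by norm_num)
  have hderiv : deriv (f ∘ ℓ) =ᶠ[nhds 0] fun s => pd f i (ℓ s) :=
    (hℓ.eventually hdiff).mono fun s hs =>
      (hs.hasFDerivAt.comp_hasDerivAt s (hℓd s)).deriv
  have hderiv2 : deriv (deriv (f ∘ ℓ)) 0 = pd (fun y => pd f i y) i x := by
    rw [hderiv.deriv_eq]
    have h : HasFDerivAt (fun y => pd f i y) (fderiv ℝ (fun y => pd f i y) x) (ℓ 0) := by
      rw [hℓ0]
      exact (hf.differentiableAt_pd i).hasFDerivAt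
    exact (h.comp_hasDerivAt 0 (hℓd 0)).deriv
  have hmaxℓ : IsLocalMax (f ∘ ℓ) 0 := by
    filter_upwards [hℓ.eventually hmax] with s hs
    simpa [hℓ0] using hs
  by_contra! hpos
  have hcont : ContinuousAt (f ∘ ℓ) 0 :=
    ContinuousAt.comp (by rw [hℓ0]; exact hf.continuousAt) (hℓd 0).continuousAt
  have hmin : IsLocalMin (f ∘ ℓ) 0 :=
    isLocalMin_of_deriv_deriv_pos (hderiv2 ▸ hpos) hmaxℓ.deriv_eq_zero hcont
  have hconst : f ∘ ℓ =ᶠ[nhds 0] fun _ => (f ∘ ℓ) 0 := by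
    filter_upwards [hmaxℓ, hmin] with s h₁ h₂ using le_antisymm h₁ h₂
  have hzero : deriv (deriv (f ∘ ℓ)) 0 = 0 := by
    rw [hconst.deriv.deriv_eq]
    simp
  linarith

/-- At a maximum of a function on an interval with right endpoint, the derivative is
nonnegative. -/
theorem HasDerivAt.nonneg_of_forall_le_left {g : ℝ → ℝ} {g' a t : ℝ} (hat : a < t)
    (hg : HasDerivAt g g' t) (hmax : ∀ s ∈ Ioo a t, g s ≤ g t) : 0 ≤ g' := by
  have h := (hasDerivAt_iff_tendsto_slope.1 hg).mono_left
    (nhdsWithin_mono t (fun s (hs : s ∈ Iio t) => ne_of_lt hs))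
  refine ge_of_tendsto h ?_
  filter_upwards [Ioo_mem_nhdsLT hat] with s hs
  rw [slope_def_field]
  exact div_nonneg_of_nonpos (by linarith [hmax s hs]) (by linarith [hs.2])

theorem stmt5
    (n : ℕ) (hn : 0 < n)
    (Ω : Set (EuclideanSpace ℝ (Fin n)))
    (hΩo : IsOpen Ω) (hΩconn : IsConnected Ω)
    (hΩbd : Bornology.IsBounded Ω) (hΩsph : ExteriorSphereCond Ω)
    (T : ℝ) (hT : 0 < T)
    (γ : ℝ) (hγ : γ ∈ Ioo (0:ℝ) 1)
    (p : Fin n → EuclideanSpace ℝ (Fin n) → ℝ)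
    (hp : ∀ i, C1HolderOn γ (closure Ω) (p i))
    (hp1 : ∀ i, ∀ x ∈ closure Ω, -1 < p i x)
    (ε₀ : ℝ) (hε₀ : 0 < ε₀)
    (F : EuclideanSpace ℝ (Fin n) → ℝ → EuclideanSpace ℝ (Fin n) → ℝ)
    (hF : ContinuousOn
      (fun q : EuclideanSpace ℝ (Fin n) × ℝ × EuclideanSpace ℝ (Fin n) => F q.1 q.2.1 q.2.2)
      (closure Ω ×ˢ (univ : Set (ℝ × EuclideanSpace ℝ (Fin n)))))
    (hFmono : ∀ x ∈ closure Ω, ∀ v w : ℝ, ∀ z : EuclideanSpace ℝ (Fin n),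
      w ≤ v → F x v z ≤ F x w z)
    (ψ u₀ : EuclideanSpace ℝ (Fin n) → ℝ)
    (U : Set (EuclideanSpace ℝ (Fin n))) (hU : IsOpen U) (hUΩ : closure Ω ⊆ U)
    (hu₀ : ContDiffOn ℝ 2 u₀ U)
    (hu₀ψ : ∀ x ∈ frontier Ω, u₀ x = ψ x)
    (M : ℝ) (hM : 0 < M)
    (ε : ℝ) (hε : ε ∈ Ioc (0:ℝ) ε₀)
    (u : ℝ → EuclideanSpace ℝ (Fin n) → ℝ)
    (hu : IsClassicalSolAniso Ω T p F ψ u₀ ε u)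
    (hub : ∀ t ∈ Icc 0 T, ∀ x ∈ closure Ω, |u t x| ≤ M)
    (A B K : ℝ)
    (hA : IsLUB {a : ℝ | ∃ ε' ∈ Icc (0:ℝ) ε₀, ∃ x ∈ closure Ω,
      a = |∑ i, pd (fun y => ((pd u₀ i y) ^ 2 + ε') ^ (p i y / 2) * pd u₀ i y) i x|} A)
    (hB : IsLUB {a : ℝ | ∃ x ∈ closure Ω, ∃ v ∈ Icc (-M) M,
      a = |F x v (gradv u₀ x)|} B)
    (hK : K = A + B)
    :
    ∀ δ : ℝ, 0 < δ → ∀ t ∈ Icc 0 T, ∀ x ∈ closure Ω,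
      u t x - u₀ x ≤ (K + δ) * t := by
  intro δ hδ
  have hΩc : IsCompact (closure Ω) := hΩbd.isCompact_closure
  have hAK (x) (hx : x ∈ closure Ω) := hA.1 ⟨ε, ⟨hε.1.le, hε.2⟩, x, hx, rfl⟩
  have hBK (x) (hx : x ∈ closure Ω) (v) (hv : v ∈ Icc (-M) M) := hB.1 ⟨x, hx, v, hv, rfl⟩
  have hK0 : 0 ≤ K := by
    obtain ⟨x, hx⟩ := hΩconn.nonempty
    have h₁ := (abs_nonneg _).trans (hAK x (subset_closure hx))
    have h₂ := (abs_nonneg _).trans (hBK x (subset_closure hx) 0 ⟨by linarith, hM.le⟩)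
    linarith
  have hu₀c : ContinuousOn u₀ (closure Ω) := hu₀.continuousOn.mono hUΩ
  have hinterior : ∀ t ∈ Ico 0 T, ∀ x ∈ closure Ω, u t x - u₀ x ≤ (K + δ) * t := by
    intro τ hτ y hy
    let w : ℝ × EuclideanSpace ℝ (Fin n) → ℝ := fun q => u q.1 q.2 - u₀ q.2 - (K + δ) * q.1
    have hwc : ContinuousOn w (Icc 0 τ ×ˢ closure Ω) := by
      refine ((hu.cont.mono (prod_mono (Icc_subset_Icc_right hτ.2.le) subset_rfl)).sub
        (hu₀c.comp continuousOn_snd fun q hq => hq.2)).sub ?_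
      fun_prop
    obtain ⟨⟨t, x⟩, ⟨ht, hx⟩, hmax⟩ := (isCompact_Icc.prod hΩc).exists_isMaxOn
      ⟨(τ, y), ⟨hτ.1, le_rfl⟩, hy⟩ hwc
    simp only at ht hx
    have hle (s) (hs : s ∈ Icc 0 τ) (z) (hz : z ∈ closure Ω) :
        u s z - u₀ z - (K + δ) * s ≤ u t x - u₀ x - (K + δ) * t :=
      hmax (show (s, z) ∈ Icc 0 τ ×ˢ closure Ω from ⟨hs, hz⟩)
    by_contra! hcon
    have hpos : 0 < u t x - u₀ x - (K + δ) * t := by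
      linarith [hle τ ⟨hτ.1, le_rfl⟩ y hy]
    have ht0 : 0 < t := by
      refine ht.1.lt_of_ne fun h => ?_
      subst h
      rw [hu.init x hx] at hpos
      linarith
    have htT : t ∈ Ioo 0 T := ⟨ht0, ht.2.trans_lt hτ.2⟩
    have hxΩ : x ∈ Ω := by
      by_contra hxn
      have hxf : x ∈ frontier Ω := by
        rw [hΩo.frontier_eq]
        exact ⟨hx, hxn⟩
      rw [hu.bdry t htT x hxf, hu₀ψ x hxf] at hpos
      nlinarith
    have htime : K + δ ≤ deriv (fun s => u s x) t := by
      have h := ((hu.diff_t t htT x hxΩ).hasDerivAt.sub_const (u₀ x)).sub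
        ((hasDerivAt_id t).const_mul (K + δ))
      have := h.nonneg_of_forall_le_left ht0 fun s hs =>
        hle s ⟨hs.1.le, hs.2.le.trans ht.2⟩ x hx
      linarith
    have hus : ContDiffAt ℝ 2 (u t) x := hu.smooth_x t htT x hxΩ
    have hu₀s : ContDiffAt ℝ 2 u₀ x := hu₀.contDiffAt (hU.mem_nhds (hUΩ hx))
    have hspace : IsLocalMax (u t - u₀) x := by
      filter_upwards [hΩo.mem_nhds hxΩ] with z hz
      have := hle t ht z (subset_closure hz)
      simp only [Pi.sub_apply]
      linarith
    have hgrad (i : Fin n) : pd (u t) i x = pd u₀ i x := by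
      have h := hspace.fderiv_eq_zero
      rw [fderiv_sub (hus.differentiableAt (by norm_num)) (hu₀s.differentiableAt (by norm_num)),
        sub_eq_zero] at h
      simp only [pd, h]
    have hhess (i : Fin n) : pd (fun y => pd (u t) i y) i x ≤ pd (fun y => pd u₀ i y) i x := by
      have h := hspace.pd_pd_nonpos (hus.sub hu₀s) i
      have hev : (fun y => pd (u t - u₀) i y) =ᶠ[nhds x]
          ((fun y => pd (u t) i y) - fun y => pd u₀ i y) := by
        filter_upwards [hus.eventually (by simp), hu₀s.eventually (by simp)] with z h₁ h₂
        simp only [pd, Pi.sub_apply]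
        rw [fderiv_sub (h₁.differentiableAt (by norm_num)) (h₂.differentiableAt (by norm_num))]
        rfl
      rw [pd, hev.fderiv_eq,
        fderiv_sub (hus.differentiableAt_pd i) (hu₀s.differentiableAt_pd i)] at h
      exact sub_nonpos.1 h
    have hsum : (∑ i, pd (fun y => ((pd (u t) i y) ^ 2 + ε) ^ (p i y / 2) * pd (u t) i y) i x) ≤
        ∑ i, pd (fun y => ((pd u₀ i y) ^ 2 + ε) ^ (p i y / 2) * pd u₀ i y) i x := by
      refine Finset.sum_le_sum fun i _ => ?_
      have hpi : DifferentiableAt ℝ (p i) x :=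
        ((hp i).1.differentiableOn (by norm_num)).differentiableAt
          (mem_of_superset (hΩo.mem_nhds hxΩ) subset_closure)
      rw [pd_flux hε.1 (hus.differentiableAt_pd i) hpi,
        pd_flux hε.1 (hu₀s.differentiableAt_pd i) hpi, hgrad i]
      have h1 : 0 ≤ 1 + p i x := by linarith [hp1 i x hx]
      have := hε.1
      gcongr
      exact hhess i
    have hgradv : gradv (u t) x = gradv u₀ x := by
      simp only [gradv, hgrad]
    have heqn := hu.eqn t htT x hxΩ
    rw [hgradv] at heqn
    have hAx := (le_abs_self _).trans (hAK x hx)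
    have hBx := (le_abs_self _).trans
      (hBK x hx (u t x) (abs_le.1 (hub t ⟨ht.1, htT.2.le⟩ x hx)))
    linarith
  intro t ht x hx
  have hclos : closure (Ico 0 T) = Icc 0 T := closure_Ico hT.ne
  refine le_on_closure (s := Ico 0 T) (f := fun s => u s x - u₀ x) (g := fun s => (K + δ) * s)
    (fun s hs => hinterior s hs x hx) ?_ (by fun_prop) (hclos ▸ ht)
  rw [hclos]
  exact (hu.cont.comp (f := fun s : ℝ => (s, x)) (by fun_prop) fun s hs => ⟨hs, hx⟩).sub
    continuousOn_const
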